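/- arXiv:math/0210370 — 2 statements merged into one kernel-verified Lean document; each statement's English description precedes it below -/
import Mathlib

section
/- Let λ < 0 and let φ : [1,∞) → ℝ be a continuous function that is weakly bounded by b^{λ}. Then for every a ≥ 1 the integral L(a,φ) = ∫_{1}^{∞} (a² + b²)^{-1/2} φ(b) db converges absolutely. Moreover, as a function of a ∈ [1,∞): if -1 ≤ λ < 0 then L(a,φ) is weakly bounded by a^{λ}, and if λ < -1 then there is a constant C > 0 with |L(a,φ)| ≤ C a^{-1} for all a ≥ 1. -/
open MeasureTheory Set

/-- A function `f : [1,∞) → ℝ` is weakly bounded by `a^{λ}` if there exists `δ₀ > 0`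
such that for every `δ ∈ (0, δ₀)` there exists `C > 0` with
`|f(a)| ≤ C a^{λ(1-δ)}` for all `a ≥ 1`. -/
def WeaklyBounded (f : ℝ → ℝ) (lam : ℝ) : Prop :=
  ∃ δ₀ > (0 : ℝ), ∀ δ : ℝ, 0 < δ → δ < δ₀ →
    ∃ C > (0 : ℝ), ∀ a : ℝ, 1 ≤ a → |f a| ≤ C * a ^ (lam * (1 - δ))

/-- A weighted geometric mean of the bounds `(a² + b²)^{-1/2} ≤ a⁻¹` and
`(a² + b²)^{-1/2} ≤ b⁻¹`. -/
lemma rpow_add_sq_le_mul_rpow {a b θ : ℝ} (ha : 0 < a) (hb : 0 < b) (h0 : 0 ≤ θ) (h1 : θ ≤ 1) :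
    (a ^ 2 + b ^ 2) ^ (-(1 : ℝ) / 2) ≤ a ^ (θ - 1) * b ^ (-θ) := by
  have key : ∀ c t : ℝ, 0 < c → c ^ 2 ≤ a ^ 2 + b ^ 2 → t ≤ 0 →
      (a ^ 2 + b ^ 2) ^ (t / 2) ≤ c ^ t := fun c t hc hle ht =>
    calc (a ^ 2 + b ^ 2) ^ (t / 2) ≤ (c ^ 2) ^ (t / 2) :=
          Real.rpow_le_rpow_of_nonpos (by positivity) hle (by linarith)
      _ = c ^ t := by
          rw [← Real.rpow_natCast, ← Real.rpow_mul hc.le]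
          congr 1
          push_cast
          ring
  calc (a ^ 2 + b ^ 2) ^ (-(1 : ℝ) / 2)
      = (a ^ 2 + b ^ 2) ^ ((θ - 1) / 2) * (a ^ 2 + b ^ 2) ^ (-θ / 2) := by
        rw [← Real.rpow_add (by positivity)]
        congr 1
        ring
    _ ≤ a ^ (θ - 1) * b ^ (-θ) := by
        gcongr
        · exact key a _ ha (by nlinarith) (by linarith)
        · exact key b _ hb (by nlinarith) (by linarith)

/-- If `|φ(b)| ≤ C b^μ` on `[1,∞)` with `μ < θ - 1` and `θ ∈ [0,1]`, then
`∫_{1}^{∞} (a² + b²)^{-1/2} φ(b) db` converges absolutely and is `O(a^{θ - 1})`. -/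
lemma integrableOn_and_abs_integral_le {φ : ℝ → ℝ} {C μ θ : ℝ}
    (hcont : ContinuousOn φ (Ici (1 : ℝ))) (hC : 0 < C)
    (hφ : ∀ b : ℝ, 1 ≤ b → |φ b| ≤ C * b ^ μ) (h0 : 0 ≤ θ) (h1 : θ ≤ 1) (hμ : μ < θ - 1) :
    ∃ D > (0 : ℝ), ∀ a : ℝ, 1 ≤ a →
      IntegrableOn (fun b : ℝ => (a ^ 2 + b ^ 2) ^ (-(1 : ℝ) / 2) * φ b) (Ici (1 : ℝ)) ∧
      |∫ b in Ici (1 : ℝ), (a ^ 2 + b ^ 2) ^ (-(1 : ℝ) / 2) * φ b| ≤ D * a ^ (θ - 1) := by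
  have hint : IntegrableOn (fun b : ℝ => b ^ (μ - θ)) (Ici (1 : ℝ)) :=
    (integrableOn_Ici_iff_integrableOn_Ioi (by finiteness)).2
      (integrableOn_Ioi_rpow_of_lt (by linarith) one_pos)
  have hnonneg : 0 ≤ ∫ b in Ici (1 : ℝ), b ^ (μ - θ) :=
    setIntegral_nonneg measurableSet_Ici fun b hb =>
      Real.rpow_nonneg (zero_le_one.trans hb) _
  refine ⟨C * (∫ b in Ici (1 : ℝ), b ^ (μ - θ)) + 1, by positivity, fun a ha => ?_⟩
  have ha0 : 0 < a := by linarith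
  have hbound : ∀ᵐ b ∂volume.restrict (Ici (1 : ℝ)),
      ‖(a ^ 2 + b ^ 2) ^ (-(1 : ℝ) / 2) * φ b‖ ≤ a ^ (θ - 1) * C * b ^ (μ - θ) := by
    filter_upwards [ae_restrict_mem measurableSet_Ici] with b hb
    have hb1 : (1 : ℝ) ≤ b := hb
    have hb0 : 0 < b := by linarith
    rw [norm_mul, Real.norm_eq_abs, Real.norm_eq_abs,
      abs_of_nonneg (Real.rpow_nonneg (by positivity) _)]
    calc (a ^ 2 + b ^ 2) ^ (-(1 : ℝ) / 2) * |φ b|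
        ≤ (a ^ (θ - 1) * b ^ (-θ)) * (C * b ^ μ) :=
          mul_le_mul (rpow_add_sq_le_mul_rpow ha0 hb0 h0 h1) (hφ b hb1) (abs_nonneg _)
            (by positivity)
      _ = a ^ (θ - 1) * C * b ^ (μ - θ) := by
          rw [sub_eq_add_neg μ θ, Real.rpow_add hb0]
          ring
  have hdom := hint.const_mul (a ^ (θ - 1) * C)
  refine ⟨hdom.mono' (ContinuousOn.aestronglyMeasurable ?_ measurableSet_Ici) hbound, ?_⟩
  · refine ContinuousOn.mul (ContinuousOn.rpow_const (by fun_prop) fun b _ => ?_) hcont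
    exact Or.inl (by positivity)
  · have h := norm_integral_le_of_norm_le hdom hbound
    rw [integral_const_mul, Real.norm_eq_abs] at h
    have : 0 < a ^ (θ - 1) := by positivity
    linarith

/-- Let `λ < 0` and let `φ : [1,∞) → ℝ` be continuous and weakly bounded by `b^{λ}`.
Then for every `a ≥ 1` the integral `L(a,φ) = ∫_{1}^{∞} (a² + b²)^{-1/2} φ(b) db`
converges absolutely; if `-1 ≤ λ < 0` then `L(a,φ)` is weakly bounded by `a^{λ}`,
and if `λ < -1` then `|L(a,φ)| ≤ C a^{-1}` for some `C > 0` and all `a ≥ 1`. -/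
theorem stmt_6 (lam : ℝ) (hlam : lam < 0) (φ : ℝ → ℝ)
    (hcont : ContinuousOn φ (Ici (1 : ℝ))) (hwb : WeaklyBounded φ lam) :
    (∀ a : ℝ, 1 ≤ a →
      IntegrableOn (fun b : ℝ => (a ^ 2 + b ^ 2) ^ (-(1 : ℝ) / 2) * φ b) (Ici (1 : ℝ))) ∧
    (-1 ≤ lam →
      WeaklyBounded
        (fun a : ℝ => ∫ b in Ici (1 : ℝ), (a ^ 2 + b ^ 2) ^ (-(1 : ℝ) / 2) * φ b) lam) ∧
    (lam < -1 → ∃ C > (0 : ℝ), ∀ a : ℝ, 1 ≤ a →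
      |∫ b in Ici (1 : ℝ), (a ^ 2 + b ^ 2) ^ (-(1 : ℝ) / 2) * φ b| ≤ C * a ^ (-1 : ℝ)) := by
  obtain ⟨δ₀, hδ₀, H⟩ := hwb
  refine ⟨fun a ha => ?_, fun hlam1 => ?_, fun hlam1 => ?_⟩
  · have hm : 0 < min δ₀ 1 := lt_min hδ₀ one_pos
    have hm0 := min_le_left δ₀ 1
    have hm1 := min_le_right δ₀ 1
    obtain ⟨C, hC, hφ⟩ := H (min δ₀ 1 / 2) (by linarith) (by linarith)
    obtain ⟨D, -, h⟩ := integrableOn_and_abs_integral_le (θ := 1) hcont hC hφ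
      zero_le_one le_rfl (by nlinarith)
    exact (h a ha).1
  · refine ⟨min δ₀ 1, lt_min hδ₀ one_pos, fun δ hδ hδm => ?_⟩
    have hδ0 := hδm.trans_le (min_le_left δ₀ 1)
    have hδ1 := hδm.trans_le (min_le_right δ₀ 1)
    obtain ⟨C, hC, hφ⟩ := H (δ / 2) (by linarith) (by linarith)
    obtain ⟨D, hD, h⟩ := integrableOn_and_abs_integral_le (θ := lam * (1 - δ) + 1) hcont hC hφ
      (by nlinarith) (by nlinarith) (by nlinarith)
    refine ⟨D, hD, fun a ha => ?_⟩
    simpa using (h a ha).2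
  · have hε : 0 < (lam + 1) / lam := div_pos_of_neg_of_neg (by linarith) hlam
    have hmul : lam * ((lam + 1) / lam) = lam + 1 := mul_div_cancel₀ _ hlam.ne
    have hm : 0 < min δ₀ ((lam + 1) / lam) := lt_min hδ₀ hε
    have hm0 := min_le_left δ₀ ((lam + 1) / lam)
    have hm1 := min_le_right δ₀ ((lam + 1) / lam)
    obtain ⟨C, hC, hφ⟩ := H (min δ₀ ((lam + 1) / lam) / 2) (by linarith) (by linarith)
    obtain ⟨D, hD, h⟩ := integrableOn_and_abs_integral_le (θ := 0) hcont hC hφ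
      le_rfl zero_le_one (by nlinarith)
    refine ⟨D, hD, fun a ha => ?_⟩
    simpa using (h a ha).2
end

section
/- Let p ≥ 1, let B⁺ = {b ∈ ℝ^p : b₁ ≥ b₂ ≥ … ≥ b_p ≥ 1}, and let λ ∈ ℝ^p satisfy λ ≺ 0. Then for every a ≥ 1 the integral L(a,λ) = ∫_{B⁺} ∏_{i=1}^{p} (a² + b_i²)^{-1/2} b_i^{λ_i} db₁…db_p is finite. Moreover, for any η ∈ [0,1]^p with λ + η ≺ 0, there is a constant C > 0 (depending on λ and η but not on a) such that L(a,λ) ≤ C a^{-(η₁ + … + η_p)} for all a ≥ 1. -/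
open MeasureTheory Set Finset

/-- The region `B⁺ = {b ∈ ℝ^p : b₁ ≥ b₂ ≥ … ≥ b_p ≥ 1}`. -/
def Bplus (p : ℕ) : Set (Fin p → ℝ) :=
  {b | (∀ i, 1 ≤ b i) ∧ ∀ i j : Fin p, i ≤ j → b j ≤ b i}

/-- If `x` is antitone and nonnegative and the partial sums of `v` are nonpositive, then
`∑ v i * x i ≤ 0`. -/
theorem sum_mul_nonpos_of_antitone (n : ℕ) (v x : Fin n → ℝ)
    (hv : ∀ j, ∑ i ∈ Finset.Iic j, v i ≤ 0) (hx : Antitone x) (hx0 : ∀ i, 0 ≤ x i) :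
    ∑ i, v i * x i ≤ 0 := by
  induction n with
  | zero => simp
  | succ n ih =>
    have h := ih (fun i => v i.castSucc) (fun i => x i.castSucc - x (Fin.last n))
      (fun j => by
        have := hv j.castSucc
        rwa [← Fin.map_castSuccEmb_Iic, Finset.sum_map] at this)
      (fun i j hij => by
        have := hx (Fin.castSucc_le_castSucc_iff.2 hij)
        simpa using this)
      (fun i => sub_nonneg.2 (hx (Fin.le_last _)))
    have hlast : ∑ i, v i ≤ 0 := by
      have := hv (Fin.last n)
      rwa [show Finset.Iic (Fin.last n) = Finset.univ from by
        ext i; simp [Fin.le_last]] at this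
    have h2 := mul_nonpos_of_nonpos_of_nonneg hlast (hx0 (Fin.last n))
    rw [Fin.sum_univ_castSucc] at h2 ⊢
    simp only [mul_sub, Finset.sum_sub_distrib, ← Finset.sum_mul] at h
    linarith

/-- If all partial sums of `v` are negative, they stay nonpositive after adding a small positive
constant to each term. -/
theorem exists_pos_sum_Iic_add_nonpos {p : ℕ} (v : Fin p → ℝ)
    (hv : ∀ j, ∑ i ∈ Finset.Iic j, v i < 0) :
    ∃ ε > 0, ∀ j, ∑ i ∈ Finset.Iic j, (v i + ε) ≤ 0 := by
  have h : ∀ᶠ ε in nhdsWithin (0 : ℝ) (Set.Ioi 0),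
      ∀ j, ∑ i ∈ Finset.Iic j, (v i + ε) < 0 := by
    refine Filter.eventually_all.2 fun j => ?_
    have hc : Continuous fun ε : ℝ => ∑ i ∈ Finset.Iic j, (v i + ε) := by fun_prop
    exact (hc.tendsto 0).mono_left nhdsWithin_le_nhds |>.eventually_lt_const (by simpa using hv j)
  obtain ⟨ε, hε, hpos⟩ := (h.and self_mem_nhdsWithin).exists
  exact ⟨ε, hpos, fun j => (hε j).le⟩

theorem measurableSet_Bplus (p : ℕ) : MeasurableSet (Bplus p) := by
  unfold Bplus
  measurability

theorem prod_rpow_le_of_mem_Bplus {p : ℕ} {b v w : Fin p → ℝ} (hb : b ∈ Bplus p)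
    (h : ∀ j, ∑ i ∈ Finset.Iic j, (v i - w i) ≤ 0) :
    ∏ i, b i ^ v i ≤ ∏ i, b i ^ w i := by
  have hpos : ∀ i, 0 < b i := fun i => one_pos.trans_le (hb.1 i)
  have key := sum_mul_nonpos_of_antitone p (fun i => v i - w i) (fun i => Real.log (b i)) h
    (fun i j hij => Real.log_le_log (hpos j) (hb.2 i j hij)) (fun i => Real.log_nonneg (hb.1 i))
  simp only [fun (u : Fin p → ℝ) i => Real.rpow_def_of_pos (hpos i) (u i), ← Real.exp_sum]
  refine Real.exp_le_exp.2 ?_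
  simp only [sub_mul, Finset.sum_sub_distrib] at key
  simp only [mul_comm (Real.log _)]
  linarith

theorem integrableOn_Bplus_prod_rpow {p : ℕ} (v : Fin p → ℝ)
    (hv : ∀ j, ∑ i ∈ Finset.Iic j, v i < 0) :
    IntegrableOn (fun b : Fin p → ℝ => ∏ i, b i ^ (v i - 1)) (Bplus p) := by
  obtain ⟨ε, hε, hsum⟩ := exists_pos_sum_Iic_add_nonpos v hv
  have h1 : IntegrableOn (fun t : ℝ => t ^ (-ε - 1)) (Set.Ici 1) := by
    rw [integrableOn_Ici_iff_integrableOn_Ioi]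
    exact integrableOn_Ioi_rpow_of_lt (by linarith) one_pos
  have h2 : IntegrableOn (fun b : Fin p → ℝ => ∏ i, b i ^ (-ε - 1))
      (Set.univ.pi fun _ => Set.Ici 1) := by
    rw [IntegrableOn, volume_pi, Measure.restrict_pi_pi]
    exact Integrable.fintype_prod fun _ => h1
  have h3 := h2.mono_set (s := Bplus p) fun b hb i _ => hb.1 i
  refine Integrable.mono' h3 (Measurable.aestronglyMeasurable (by fun_prop)) ?_
  refine (ae_restrict_iff' (measurableSet_Bplus p)).2 (.of_forall fun b hb => ?_)
  have hnn : 0 ≤ ∏ i, b i ^ (v i - 1) :=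
    Finset.prod_nonneg fun i _ => Real.rpow_nonneg (zero_le_one.trans (hb.1 i)) _
  rw [Real.norm_of_nonneg hnn]
  refine prod_rpow_le_of_mem_Bplus hb fun j => ?_
  convert hsum j using 2
  ring

/-- Weighted interpolation between `(a² + b²)^{-1/2} ≤ a⁻¹` and `(a² + b²)^{-1/2} ≤ b⁻¹`. -/
theorem add_sq_rpow_neg_half_le {a b θ : ℝ} (ha : 0 < a) (hb : 0 < b)
    (hθ : θ ∈ Set.Icc (0 : ℝ) 1) :
    (a ^ 2 + b ^ 2) ^ (-(1 : ℝ) / 2) ≤ a ^ (-θ) * b ^ (θ - 1) := by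
  have hs : 0 < a ^ 2 + b ^ 2 := by positivity
  have key : ∀ c : ℝ, 0 < c → c ^ 2 ≤ a ^ 2 + b ^ 2 → ∀ t : ℝ, 0 ≤ t →
      (a ^ 2 + b ^ 2) ^ (-t / 2) ≤ c ^ (-t) := by
    intro c hc hle t ht
    calc (a ^ 2 + b ^ 2) ^ (-t / 2) ≤ (c ^ 2) ^ (-t / 2) :=
          Real.rpow_le_rpow_of_nonpos (by positivity) hle (by linarith)
      _ = c ^ (-t) := by
          rw [← Real.rpow_natCast, ← Real.rpow_mul hc.le]
          congr 1
          push_cast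
          ring
  calc (a ^ 2 + b ^ 2) ^ (-(1 : ℝ) / 2)
      = (a ^ 2 + b ^ 2) ^ (-θ / 2) * (a ^ 2 + b ^ 2) ^ (-(1 - θ) / 2) := by
        rw [← Real.rpow_add hs]
        congr 1
        ring
    _ ≤ a ^ (-θ) * b ^ (-(1 - θ)) :=
        mul_le_mul (key a ha (by nlinarith) θ hθ.1) (key b hb (by nlinarith) _ (by linarith [hθ.2]))
          (by positivity) (by positivity)
    _ = a ^ (-θ) * b ^ (θ - 1) := by rw [neg_sub]

theorem prod_integrand_le {p : ℕ} {a : ℝ} (ha : 0 < a) {b lam η : Fin p → ℝ}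
    (hb : ∀ i, 0 < b i) (hη : ∀ i, η i ∈ Set.Icc (0 : ℝ) 1) :
    ∏ i, (a ^ 2 + b i ^ 2) ^ (-(1 : ℝ) / 2) * b i ^ lam i ≤
      a ^ (-(∑ i, η i)) * ∏ i, b i ^ (lam i + η i - 1) := by
  rw [← Finset.sum_neg_distrib, Real.rpow_sum_of_pos ha, ← Finset.prod_mul_distrib]
  refine Finset.prod_le_prod (fun i _ => ?_) fun i _ => ?_
  · have := hb i
    positivity
  · calc (a ^ 2 + b i ^ 2) ^ (-(1 : ℝ) / 2) * b i ^ lam i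
        ≤ a ^ (-η i) * b i ^ (η i - 1) * b i ^ lam i :=
          mul_le_mul_of_nonneg_right (add_sq_rpow_neg_half_le ha (hb i) (hη i))
            (Real.rpow_nonneg (hb i).le _)
      _ = a ^ (-η i) * b i ^ (lam i + η i - 1) := by
          rw [mul_assoc, ← Real.rpow_add (hb i)]
          ring_nf

theorem integrableOn_Bplus_integrand {p : ℕ} {a : ℝ} (ha : 0 < a) (lam : Fin p → ℝ)
    (hlam : ∀ j : Fin p, ∑ i ∈ Finset.Iic j, lam i < 0) :
    IntegrableOn
      (fun b : Fin p → ℝ => ∏ i, (a ^ 2 + b i ^ 2) ^ (-(1 : ℝ) / 2) * b i ^ lam i)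
      (Bplus p) := by
  refine Integrable.mono' (integrableOn_Bplus_prod_rpow lam hlam)
    (Measurable.aestronglyMeasurable (by fun_prop)) ?_
  refine (ae_restrict_iff' (measurableSet_Bplus p)).2 (.of_forall fun b hb => ?_)
  have hpos : ∀ i, 0 < b i := fun i => one_pos.trans_le (hb.1 i)
  rw [Real.norm_of_nonneg (Finset.prod_nonneg fun i _ => by have := hpos i; positivity)]
  simpa using prod_integrand_le ha (lam := lam) (η := fun _ => 0) hpos (by simp)

/-- Let `p ≥ 1` and `λ ∈ ℝ^p` with `λ ≺ 0`. Then for every `a ≥ 1` the integral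
`L(a,λ) = ∫_{B⁺} ∏ᵢ (a² + bᵢ²)^{-1/2} bᵢ^{λᵢ} db` is finite. Moreover, for any
`η ∈ [0,1]^p` with `λ + η ≺ 0`, there is `C > 0` (independent of `a`) with
`L(a,λ) ≤ C a^{-(η₁+…+η_p)}` for all `a ≥ 1`. -/
theorem stmt_7 (p : ℕ) (hp : 1 ≤ p) (lam : Fin p → ℝ)
    (hlam : ∀ j : Fin p, ∑ i ∈ Finset.Iic j, lam i < 0) :
    (∀ a : ℝ, 1 ≤ a →
      IntegrableOn
        (fun b : Fin p → ℝ => ∏ i, (a ^ 2 + b i ^ 2) ^ (-(1 : ℝ) / 2) * b i ^ lam i)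
        (Bplus p)) ∧
    (∀ η : Fin p → ℝ, (∀ i, η i ∈ Set.Icc (0 : ℝ) 1) →
      (∀ j : Fin p, ∑ i ∈ Finset.Iic j, (lam i + η i) < 0) →
      ∃ C > (0 : ℝ), ∀ a : ℝ, 1 ≤ a →
        (∫ b in Bplus p, ∏ i, (a ^ 2 + b i ^ 2) ^ (-(1 : ℝ) / 2) * b i ^ lam i) ≤
          C * a ^ (-(∑ i, η i))) := by
  refine ⟨fun a ha => integrableOn_Bplus_integrand (one_pos.trans_le ha) lam hlam,
    fun η hη hsum => ?_⟩
  set I := ∫ b in Bplus p, ∏ i, b i ^ (lam i + η i - 1) with hI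
  refine ⟨max I 1, by positivity, fun a ha => ?_⟩
  have ha0 : 0 < a := one_pos.trans_le ha
  calc (∫ b in Bplus p, ∏ i, (a ^ 2 + b i ^ 2) ^ (-(1 : ℝ) / 2) * b i ^ lam i)
      ≤ ∫ b in Bplus p, a ^ (-(∑ i, η i)) * ∏ i, b i ^ (lam i + η i - 1) :=
        setIntegral_mono_on (integrableOn_Bplus_integrand ha0 lam hlam)
          ((integrableOn_Bplus_prod_rpow _ hsum).const_mul _) (measurableSet_Bplus p)
          fun b hb => prod_integrand_le ha0 (fun i => one_pos.trans_le (hb.1 i)) hη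
    _ = I * a ^ (-(∑ i, η i)) := by rw [integral_const_mul, mul_comm]
    _ ≤ max I 1 * a ^ (-(∑ i, η i)) :=
        mul_le_mul_of_nonneg_right (le_max_left _ _) (by positivity)
end
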